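/- (Monotonicity of the implicit method.) Let u, v, h, g : ℤ^d → ℝ be absolutely summable sequences such that u solves one implicit step with data h and v solves one implicit step with data g. If h_α ≤ g_α for every α ∈ ℤ^d, then u_α ≤ v_α for every α ∈ ℤ^d. -/

import Mathlib

open MeasureTheory Set

noncomputable section

abbrev Ed (d : ℕ) := EuclideanSpace ℝ (Fin d)

def cell (d : ℕ) (dx : ℝ) (α : Fin d → ℤ) : Set (Ed d) :=
  {x | ∀ i, dx * (α i : ℝ) < x i ∧ x i < dx * (α i : ℝ) + dx}

def ind (d : ℕ) (S : Set (Ed d)) : Ed d → ℝ :=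
  S.indicator fun _ => 1

def gam (d : ℕ) (dx : ℝ) (μ : Measure (Ed d)) (l : Fin d) : ℝ :=
  - ∫ z in {z : Ed d | dx / 2 < ‖z‖ ∧ ‖z‖ ≤ 1}, z l ∂μ

def Dup (d : ℕ) (dx : ℝ) (μ : Measure (Ed d)) (l : Fin d) (φ : Ed d → ℝ) (x : Ed d) : ℝ :=
  if 0 < gam d dx μ l then (φ (x + EuclideanSpace.single l dx) - φ x) / dx
  else (φ x - φ (x - EuclideanSpace.single l dx)) / dx

def Glow (d : ℕ) (dx : ℝ) (μ : Measure (Ed d)) (α β : Fin d → ℤ) : ℝ :=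
  (dx ^ d)⁻¹ *
    ∫ x in cell d dx α, ∫ z in {z : Ed d | dx / 2 < ‖z‖},
      (ind d (cell d dx β) (x + z) - ind d (cell d dx β) x) ∂μ

def Gup (d : ℕ) (dx : ℝ) (μ : Measure (Ed d)) (α β : Fin d → ℤ) : ℝ :=
  (dx ^ d)⁻¹ *
    ∑ l : Fin d, gam d dx μ l * ∫ x in cell d dx α, Dup d dx μ l (ind d (cell d dx β)) x

def Gw (d : ℕ) (dx : ℝ) (μ : Measure (Ed d)) (α β : Fin d → ℤ) : ℝ :=
  Glow d dx μ α β + Gup d dx μ α β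

def GsplitLow (d : ℕ) (dx r : ℝ) (μ : Measure (Ed d)) (α β : Fin d → ℤ) : ℝ :=
  (dx ^ d)⁻¹ *
    ∫ x in cell d dx α, ∫ z in {z : Ed d | dx / 2 < ‖z‖ ∧ ‖z‖ ≤ r},
      (ind d (cell d dx β) (x + z) - ind d (cell d dx β) x) ∂μ

def GsplitHigh (d : ℕ) (dx r : ℝ) (μ : Measure (Ed d)) (α β : Fin d → ℤ) : ℝ :=
  (dx ^ d)⁻¹ *
      ∫ x in cell d dx α, ∫ z in {z : Ed d | r < ‖z‖},
        (ind d (cell d dx β) (x + z) - ind d (cell d dx β) x) ∂μ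
    + Gup d dx μ α β

def Aok (A : ℝ → ℝ) (LA : ℝ) : Prop :=
  Monotone A ∧ (∀ a b : ℝ, |A a - A b| ≤ LA * |a - b|) ∧ A 0 = 0

def SolvesImplicitStep (d : ℕ) (dx : ℝ) (μ : Measure (Ed d)) (A : ℝ → ℝ) (dt : ℝ)
    (u h : (Fin d → ℤ) → ℝ) : Prop :=
  ∀ α, Summable (fun β => Gw d dx μ α β * A (u β)) ∧
    u α - dt * ∑' β, Gw d dx μ α β * A (u β) = h α

def Fractional (d : ℕ) (μ : Measure (Ed d)) (lam clam : ℝ) : Prop :=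
  ∀ B : Set (Ed d), MeasurableSet B → B ⊆ {z : Ed d | 0 < ‖z‖ ∧ ‖z‖ < 1} →
    μ B ≤ ∫⁻ z in B, ENNReal.ofReal (clam * ‖z‖ ^ (-(d : ℝ) - lam))

def Lhat (d : ℕ) (dx : ℝ) (μ : Measure (Ed d)) (w : Ed d → ℝ) (x : Ed d) : ℝ :=
  (∫ z in {z : Ed d | dx / 2 < ‖z‖}, (w (x + z) - w x) ∂μ) +
    ∑ l : Fin d, gam d dx μ l * Dup d dx μ l w x

def Ubar (d : ℕ) (dx : ℝ) (U : (Fin d → ℤ) → ℝ) (x : Ed d) : ℝ :=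
  ∑' α : Fin d → ℤ, U α * ind d (cell d dx α) x

def cellAvg (d : ℕ) (dx : ℝ) (w : Ed d → ℝ) (x : Ed d) : ℝ :=
  ∑' α : Fin d → ℤ, Set.indicator (cell d dx α)
    (fun _ => (dx ^ d)⁻¹ * ∫ y in cell d dx α, w y) x

theorem measurableSet_cell (d : ℕ) (dx : ℝ) (α : Fin d → ℤ) : MeasurableSet (cell d dx α) := by
  unfold cell
  measurability

theorem volume_cell_lt_top (d : ℕ) (dx : ℝ) (α : Fin d → ℤ) : volume (cell d dx α) < ⊤ := by
  have hpre : cell d dx α = (MeasurableEquiv.toLp 2 (Fin d → ℝ)).symm ⁻¹'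
      (Set.pi univ fun i => Ioo (dx * (α i : ℝ)) (dx * (α i : ℝ) + dx)) := by
    ext x
    simp [cell]
  rw [hpre, (EuclideanSpace.volume_preserving_symm_measurableEquiv_toLp (Fin d)).measure_preimage
    (MeasurableSet.univ_pi fun i => measurableSet_Ioo).nullMeasurableSet, Real.volume_pi_Ioo]
  exact ENNReal.prod_lt_top fun i _ => ENNReal.ofReal_lt_top

theorem eq_of_mem_cell {d : ℕ} {dx : ℝ} (hdx : 0 < dx) {α β : Fin d → ℤ} {x : Ed d}
    (hα : x ∈ cell d dx α) (hβ : x ∈ cell d dx β) : α = β := by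
  funext i
  have h1 := hα i
  have h2 := hβ i
  have h3 : (α i : ℝ) < β i + 1 := by
    by_contra! h
    nlinarith
  have h4 : (β i : ℝ) < α i + 1 := by
    by_contra! h
    nlinarith
  norm_cast at h3 h4
  omega

theorem ind_nonneg (d : ℕ) (S : Set (Ed d)) (x : Ed d) : 0 ≤ ind d S x :=
  Set.indicator_nonneg (fun _ _ => zero_le_one) x

theorem ind_le_one (d : ℕ) (S : Set (Ed d)) (x : Ed d) : ind d S x ≤ 1 :=
  Set.indicator_le_self' (fun _ _ => zero_le_one) x

theorem ind_of_mem {d : ℕ} {S : Set (Ed d)} {x : Ed d} (hx : x ∈ S) : ind d S x = 1 :=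
  Set.indicator_of_mem hx _

theorem ind_of_notMem {d : ℕ} {S : Set (Ed d)} {x : Ed d} (hx : x ∉ S) : ind d S x = 0 :=
  Set.indicator_of_notMem hx _

theorem measurable_ind_cell (d : ℕ) (dx : ℝ) (α : Fin d → ℤ) :
    Measurable (ind d (cell d dx α)) :=
  measurable_const.indicator (measurableSet_cell d dx α)

theorem ind_cell_eq_zero {d : ℕ} {dx : ℝ} (hdx : 0 < dx) {α β : Fin d → ℤ} (hαβ : α ≠ β)
    {x : Ed d} (hx : x ∈ cell d dx α) : ind d (cell d dx β) x = 0 :=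
  ind_of_notMem fun hx' => hαβ (eq_of_mem_cell hdx hx hx')

theorem sum_ind_cell_le_one {d : ℕ} {dx : ℝ} (hdx : 0 < dx) (F : Finset (Fin d → ℤ)) (x : Ed d) :
    ∑ β ∈ F, ind d (cell d dx β) x ≤ 1 := by
  by_cases hx : ∃ β ∈ F, x ∈ cell d dx β
  · obtain ⟨β, hβ, hxβ⟩ := hx
    rw [Finset.sum_eq_single_of_mem β hβ fun γ _ hγ => ind_cell_eq_zero hdx hγ.symm hxβ]
    exact ind_le_one _ _ _
  · push Not at hx
    rw [Finset.sum_eq_zero fun β hβ => ind_of_notMem (hx β hβ)]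
    exact zero_le_one

theorem sum_ind_cell_of_mem {d : ℕ} {dx : ℝ} (hdx : 0 < dx) {F : Finset (Fin d → ℤ)}
    {α : Fin d → ℤ} (hα : α ∈ F) {x : Ed d} (hx : x ∈ cell d dx α) :
    ∑ β ∈ F, ind d (cell d dx β) x = 1 := by
  rw [Finset.sum_eq_single_of_mem α hα fun γ _ hγ => ind_cell_eq_zero hdx hγ.symm hx]
  exact ind_of_mem hx

theorem measure_norm_gt_lt_top {d : ℕ} {μ : Measure (Ed d)}
    (hμ : ∫⁻ z, ENNReal.ofReal (min (‖z‖ ^ 2) 1) ∂μ < ⊤) {r : ℝ} (hr : 0 < r) :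
    μ {z : Ed d | r < ‖z‖} < ⊤ := by
  have hpos : 0 < min (r ^ 2) 1 := by positivity
  refine lt_of_le_of_lt ((measure_mono ?_).trans (meas_ge_le_lintegral_div
    (f := fun z => ENNReal.ofReal (min (‖z‖ ^ 2) 1)) (by fun_prop)
    (ENNReal.ofReal_pos.mpr hpos).ne' ENNReal.ofReal_ne_top))
    (ENNReal.div_lt_top hμ.ne (ENNReal.ofReal_pos.mpr hpos).ne')
  intro z hz
  have hz : r < ‖z‖ := hz
  simp only [mem_setOf_eq]
  gcongr

section Integrability

variable {d : ℕ} {dx : ℝ} {μ : Measure (Ed d)}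

theorem integrable_ind_add_sub_ind {ν : Measure (Ed d)} [IsFiniteMeasure ν] (β : Fin d → ℤ)
    (x : Ed d) :
    Integrable (fun z => ind d (cell d dx β) (x + z) - ind d (cell d dx β) x) ν := by
  have hm := measurable_ind_cell d dx β
  refine Integrable.of_bound (C := 1) (Measurable.aestronglyMeasurable (by fun_prop))
    (.of_forall fun z => ?_)
  rw [Real.norm_eq_abs, abs_le]
  have h1 := ind_nonneg d (cell d dx β) (x + z)
  have h2 := ind_nonneg d (cell d dx β) x
  have h3 := ind_le_one d (cell d dx β) (x + z)
  have h4 := ind_le_one d (cell d dx β) x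
  constructor <;> linarith

theorem integrableOn_integral_ind_add_sub_ind {ν : Measure (Ed d)} [IsFiniteMeasure ν]
    (α β : Fin d → ℤ) :
    IntegrableOn (fun x => ∫ z, (ind d (cell d dx β) (x + z) - ind d (cell d dx β) x) ∂ν)
      (cell d dx α) := by
  have hm := measurable_ind_cell d dx β
  refine IntegrableOn.of_bound (C := 1 * ν.real univ) (volume_cell_lt_top d dx α) ?_
    (.of_forall fun x => norm_integral_le_of_norm_le_const (.of_forall fun z => ?_))
  · refine (StronglyMeasurable.integral_prod_right
      (f := fun x z => ind d (cell d dx β) (x + z) - ind d (cell d dx β) x)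
      (Measurable.stronglyMeasurable ?_)).aestronglyMeasurable
    simp only [Function.uncurry_def]
    fun_prop
  · rw [Real.norm_eq_abs, abs_le]
    have h1 := ind_nonneg d (cell d dx β) (x + z)
    have h2 := ind_nonneg d (cell d dx β) x
    have h3 := ind_le_one d (cell d dx β) (x + z)
    have h4 := ind_le_one d (cell d dx β) x
    constructor <;> linarith

theorem integrableOn_ind_comp {f : Ed d → Ed d} (hf : Measurable f) (α β : Fin d → ℤ) :
    IntegrableOn (fun x => ind d (cell d dx β) (f x)) (cell d dx α) := by
  have hm := measurable_ind_cell d dx β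
  refine IntegrableOn.of_bound (C := 1) (volume_cell_lt_top d dx α)
    (Measurable.aestronglyMeasurable (by fun_prop)) (.of_forall fun x => ?_)
  rw [Real.norm_eq_abs, abs_of_nonneg (ind_nonneg _ _ _)]
  exact ind_le_one _ _ _

theorem integrableOn_Dup (l : Fin d) (α β : Fin d → ℤ) :
    IntegrableOn (Dup d dx μ l (ind d (cell d dx β))) (cell d dx α) := by
  unfold Dup
  split_ifs
  · exact ((integrableOn_ind_comp (by fun_prop) α β).sub
      (integrableOn_ind_comp measurable_id α β)).div_const dx
  · exact ((integrableOn_ind_comp measurable_id α β).sub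
      (integrableOn_ind_comp (by fun_prop) α β)).div_const dx

end Integrability

theorem Glow_nonneg {d : ℕ} {dx : ℝ} (hdx : 0 < dx) (μ : Measure (Ed d)) {α β : Fin d → ℤ}
    (hαβ : α ≠ β) : 0 ≤ Glow d dx μ α β := by
  refine mul_nonneg (by positivity) (setIntegral_nonneg (measurableSet_cell d dx α)
    fun x hx => integral_nonneg fun z => ?_)
  simp only [ind_cell_eq_zero hdx hαβ hx, sub_zero]
  exact ind_nonneg _ _ _

theorem Gup_nonneg {d : ℕ} {dx : ℝ} (hdx : 0 < dx) (μ : Measure (Ed d)) {α β : Fin d → ℤ}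
    (hαβ : α ≠ β) : 0 ≤ Gup d dx μ α β := by
  refine mul_nonneg (by positivity) (Finset.sum_nonneg fun l _ => ?_)
  rw [← integral_const_mul]
  refine setIntegral_nonneg (measurableSet_cell d dx α) fun x hx => ?_
  unfold Dup
  rw [ind_cell_eq_zero hdx hαβ hx]
  split_ifs with hγ
  · rw [sub_zero]
    exact mul_nonneg hγ.le (div_nonneg (ind_nonneg _ _ _) hdx.le)
  · rw [zero_sub, neg_div]
    exact mul_nonneg_of_nonpos_of_nonpos (not_lt.mp hγ)
      (neg_nonpos.mpr (div_nonneg (ind_nonneg _ _ _) hdx.le))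

theorem sum_Glow_nonpos {d : ℕ} {dx : ℝ} (hdx : 0 < dx) {μ : Measure (Ed d)}
    (hμ : ∫⁻ z, ENNReal.ofReal (min (‖z‖ ^ 2) 1) ∂μ < ⊤) {α : Fin d → ℤ}
    {F : Finset (Fin d → ℤ)} (hα : α ∈ F) : ∑ β ∈ F, Glow d dx μ α β ≤ 0 := by
  have : IsFiniteMeasure (μ.restrict {z : Ed d | dx / 2 < ‖z‖}) :=
    isFiniteMeasure_restrict.mpr (measure_norm_gt_lt_top hμ (half_pos hdx)).ne
  unfold Glow
  rw [← Finset.mul_sum, ← integral_finsetSum _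
    fun β _ => integrableOn_integral_ind_add_sub_ind α β]
  refine mul_nonpos_of_nonneg_of_nonpos (by positivity)
    (setIntegral_nonpos (measurableSet_cell d dx α) fun x hx => ?_)
  rw [← integral_finsetSum _ fun β _ => integrable_ind_add_sub_ind β x]
  refine integral_nonpos fun z => ?_
  simp only [Finset.sum_sub_distrib, sum_ind_cell_of_mem hdx hα hx, Pi.zero_apply]
  linarith [sum_ind_cell_le_one hdx F (x + z)]

theorem sum_Gup_nonpos {d : ℕ} {dx : ℝ} (hdx : 0 < dx) (μ : Measure (Ed d)) {α : Fin d → ℤ}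
    {F : Finset (Fin d → ℤ)} (hα : α ∈ F) : ∑ β ∈ F, Gup d dx μ α β ≤ 0 := by
  unfold Gup
  rw [← Finset.mul_sum, Finset.sum_comm]
  refine mul_nonpos_of_nonneg_of_nonpos (by positivity) (Finset.sum_nonpos fun l _ => ?_)
  rw [← Finset.mul_sum, ← integral_finsetSum _ fun β _ => integrableOn_Dup l α β,
    ← integral_const_mul]
  refine setIntegral_nonpos (measurableSet_cell d dx α) fun x hx => ?_
  unfold Dup
  split_ifs with hγ
  · rw [← Finset.sum_div, Finset.sum_sub_distrib, sum_ind_cell_of_mem hdx hα hx]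
    exact mul_nonpos_of_nonneg_of_nonpos hγ.le (div_nonpos_of_nonpos_of_nonneg
      (sub_nonpos.mpr (sum_ind_cell_le_one hdx F _)) hdx.le)
  · rw [← Finset.sum_div, Finset.sum_sub_distrib, sum_ind_cell_of_mem hdx hα hx]
    exact mul_nonpos_of_nonpos_of_nonneg (not_lt.mp hγ)
      (div_nonneg (sub_nonneg.mpr (sum_ind_cell_le_one hdx F _)) hdx.le)

theorem Gw_nonneg {d : ℕ} {dx : ℝ} (hdx : 0 < dx) (μ : Measure (Ed d)) {α β : Fin d → ℤ}
    (hαβ : α ≠ β) : 0 ≤ Gw d dx μ α β :=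
  add_nonneg (Glow_nonneg hdx μ hαβ) (Gup_nonneg hdx μ hαβ)

theorem sum_Gw_nonpos {d : ℕ} {dx : ℝ} (hdx : 0 < dx) {μ : Measure (Ed d)}
    (hμ : ∫⁻ z, ENNReal.ofReal (min (‖z‖ ^ 2) 1) ∂μ < ⊤) {α : Fin d → ℤ}
    {F : Finset (Fin d → ℤ)} (hα : α ∈ F) : ∑ β ∈ F, Gw d dx μ α β ≤ 0 := by
  unfold Gw
  rw [Finset.sum_add_distrib]
  exact add_nonpos (sum_Glow_nonpos hdx hμ hα) (sum_Gup_nonpos hdx μ hα)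

/-- Maximum principle for an operator with nonnegative off-diagonal weights and nonpositive
row sums. -/
theorem tsum_mul_nonpos_of_isMax {ι : Type*} {G a : ι → ℝ} {i : ι}
    (hG : ∀ j, i ≠ j → 0 ≤ G j) (hsum : ∀ F : Finset ι, i ∈ F → ∑ j ∈ F, G j ≤ 0)
    (hs : Summable fun j => G j * a j) (hi : 0 ≤ a i) (hmax : ∀ j, a j ≤ a i) :
    ∑' j, G j * a j ≤ 0 := by
  refine le_of_tendsto hs.hasSum ?_
  filter_upwards [Filter.eventually_ge_atTop {i}] with F hF
  calc ∑ j ∈ F, G j * a j ≤ ∑ j ∈ F, G j * a i := by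
        refine Finset.sum_le_sum fun j _ => ?_
        rcases eq_or_ne i j with rfl | hij
        · exact le_rfl
        · exact mul_le_mul_of_nonneg_left (hmax j) (hG j hij)
    _ = (∑ j ∈ F, G j) * a i := (Finset.sum_mul _ _ _).symm
    _ ≤ 0 := mul_nonpos_of_nonpos_of_nonneg (hsum F (Finset.singleton_subset_iff.mp hF)) hi

theorem exists_isMax_of_tendsto_cofinite_zero {ι : Type*} {a : ι → ℝ}
    (ha : Filter.Tendsto a Filter.cofinite (nhds 0)) {i : ι} (hi : 0 < a i) :
    ∃ k, 0 < a k ∧ ∀ j, a j ≤ a k := by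
  have hfin : {j | a i ≤ a j}.Finite := by
    simpa [Filter.eventually_cofinite] using ha.eventually_lt_const hi
  obtain ⟨k, hk, hkmax⟩ := hfin.exists_maximalFor a _ ⟨i, le_refl (a i)⟩
  refine ⟨k, hi.trans_le hk, fun j => ?_⟩
  by_cases hj : a i ≤ a j
  · exact (le_total (a j) (a k)).elim id fun h => hkmax hj h
  · exact (not_le.mp hj).le.trans hk

theorem stmt7 (d : ℕ) (hd : 1 ≤ d) (dx : ℝ) (hdx0 : 0 < dx) (hdx1 : dx < 1)
    (μ : Measure (Ed d)) (hμ0 : μ {0} = 0)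
    (hμfin : ∫⁻ z, ENNReal.ofReal (min (‖z‖ ^ 2) 1) ∂μ < ⊤)
    (A : ℝ → ℝ) (LA : ℝ) (hA : Aok A LA) (dt : ℝ) (hdt : 0 < dt)
    (u v h g : (Fin d → ℤ) → ℝ)
    (hu : Summable fun α => |u α|) (hv : Summable fun α => |v α|)
    (hh : Summable fun α => |h α|) (hg : Summable fun α => |g α|)
    (hstepu : SolvesImplicitStep d dx μ A dt u h)
    (hstepv : SolvesImplicitStep d dx μ A dt v g)
    (hhg : ∀ α, h α ≤ g α) :
    ∀ α, u α ≤ v α := by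
  have hmono := hA.1
  have key : ∀ α, 0 ≤ A (u α) - A (v α) →
      (∀ β, A (u β) - A (v β) ≤ A (u α) - A (v α)) → u α ≤ v α := by
    intro α hα hmax
    obtain ⟨hsu, heu⟩ := hstepu α
    obtain ⟨hsv, hev⟩ := hstepv α
    have hsub := hsu.tsum_sub hsv
    have hs := hsu.sub hsv
    simp only [← mul_sub] at hsub hs
    have hle := tsum_mul_nonpos_of_isMax (a := fun β => A (u β) - A (v β))
      (fun β hαβ => Gw_nonneg hdx0 μ hαβ) (fun F hF => sum_Gw_nonpos hdx0 hμfin hF) hs hα hmax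
    have hdtle := mul_nonpos_of_nonneg_of_nonpos hdt.le (hsub ▸ hle)
    rw [mul_sub] at hdtle
    linarith [hhg α]
  have htend : Filter.Tendsto (fun β => A (u β) - A (v β)) Filter.cofinite (nhds 0) := by
    have hw := ((hu.of_abs.sub hv.of_abs).tendsto_cofinite_zero.abs).const_mul LA
    rw [abs_zero, mul_zero] at hw
    exact squeeze_zero_norm (fun β => hA.2.1 (u β) (v β)) hw
  have hnonpos : ∀ β, A (u β) - A (v β) ≤ 0 := by
    by_contra! hex
    obtain ⟨β, hβ⟩ := hex
    obtain ⟨α, hα, hmax⟩ := exists_isMax_of_tendsto_cofinite_zero htend hβ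
    linarith [hmono (key α hα.le hmax)]
  intro α
  by_contra! hlt
  have hα : 0 ≤ A (u α) - A (v α) := sub_nonneg.mpr (hmono hlt.le)
  exact hlt.not_ge (key α hα fun β => (hnonpos β).trans hα)
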